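/- arXiv:2003.13018 — 7 statements merged into one kernel-verified Lean document; each statement's English description precedes it below -/
import Mathlib

section
/- Let κ < 0 and τ be real numbers, and let h : [−1,1] → ℝ be C¹, even (h(−y) = h(y)), strictly positive, and satisfy 4h(y)² + κ(1−y²) > 0 for all y ∈ [−1,1]. Then for every y ∈ [−1,1] the denominator D₁(y) := κ(1−y²) + 8(h(y)² + τ²y²) + 4·h(y)·√(4h(y)² + κ(1−y²) + 4τ²y²) is strictly positive, and the curve Γ₁(y) := 2·√((1−y²)/D₁(y)) satisfies Γ₁(y) < 2/√(−κ). -/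
/-- For `κ < 0` and `h ∈ 𝔠¹` (C¹, even, positive, with `4h(y)² + κ(1−y²) > 0`), the curve
`Γ₁` lies entirely inside the phase plane `Θ₁`: its denominator is positive and
`Γ₁(y) < 2/√(−κ)` for all `y ∈ [−1,1]`. -/
theorem Gamma1_inside_phase_plane (κ τ : ℝ) (hκ : κ < 0) (h : ℝ → ℝ)
    (hC1 : ContDiffOn ℝ 1 h (Set.Icc (-1 : ℝ) 1))
    (heven : ∀ y ∈ Set.Icc (-1 : ℝ) 1, h (-y) = h y)
    (hpos : ∀ y ∈ Set.Icc (-1 : ℝ) 1, 0 < h y)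
    (hadm : ∀ y ∈ Set.Icc (-1 : ℝ) 1, 0 < 4 * h y ^ 2 + κ * (1 - y ^ 2)) :
    ∀ y ∈ Set.Icc (-1 : ℝ) 1,
      0 < κ * (1 - y ^ 2) + 8 * (h y ^ 2 + τ ^ 2 * y ^ 2)
          + 4 * h y * Real.sqrt (4 * h y ^ 2 + κ * (1 - y ^ 2) + 4 * τ ^ 2 * y ^ 2) ∧
      2 * Real.sqrt ((1 - y ^ 2) /
          (κ * (1 - y ^ 2) + 8 * (h y ^ 2 + τ ^ 2 * y ^ 2)
            + 4 * h y * Real.sqrt (4 * h y ^ 2 + κ * (1 - y ^ 2) + 4 * τ ^ 2 * y ^ 2)))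
        < 2 / Real.sqrt (-κ) := by
  intro y hy
  have hh := hpos y hy
  have ha := hadm y hy
  have hs : 0 ≤ 1 - y ^ 2 := by nlinarith [hy.1, hy.2]
  have hr := mul_nonneg hh.le
    (Real.sqrt_nonneg (4 * h y ^ 2 + κ * (1 - y ^ 2) + 4 * τ ^ 2 * y ^ 2))
  have hty : 0 ≤ τ ^ 2 * y ^ 2 := by positivity
  set D := κ * (1 - y ^ 2) + 8 * (h y ^ 2 + τ ^ 2 * y ^ 2)
    + 4 * h y * Real.sqrt (4 * h y ^ 2 + κ * (1 - y ^ 2) + 4 * τ ^ 2 * y ^ 2) with hD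
  have hlt : (1 - y ^ 2) * (-κ) < D := by rw [hD]; linarith
  have hDpos : 0 < D := (mul_nonneg hs (neg_pos.2 hκ).le).trans_lt hlt
  refine ⟨hDpos, ?_⟩
  rw [div_eq_mul_inv 2, ← Real.sqrt_inv]
  have hq : (1 - y ^ 2) / D < (-κ)⁻¹ := by
    rw [div_lt_iff₀ hDpos, inv_mul_eq_div, lt_div_iff₀ (neg_pos.2 hκ)]
    exact hlt
  exact mul_lt_mul_of_pos_left (Real.sqrt_lt_sqrt (div_nonneg hs hDpos.le) hq) two_pos
end

section
/- Let κ < 0, τ = 0 be real numbers, and let h : [−1,1] → ℝ be C¹, even (h(−y) = h(y)), strictly positive, and satisfy 4h(y)² + κ(1−y²) > 0 for all y ∈ [−1,1]. Then for every y ∈ (−1,1), the denominator D₋₁(y) := κ(1−y²) + 8·h(y)² − 4·h(y)·√(4h(y)² + κ(1−y²)) is strictly positive and the curve Γ₋₁(y) := 2·√((1−y²)/D₋₁(y)) satisfies Γ₋₁(y) > 2/√(−κ). -/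
/-- In `H²(κ)×ℝ` (`κ < 0`, `τ = 0`), for `h ∈ 𝔠¹` the curve `Γ₋₁` does not appear in the
phase plane `Θ₋₁`: for `y ∈ (−1,1)` its denominator is positive and `Γ₋₁(y) > 2/√(−κ)`. -/
theorem Gamma_minus1_H2xR (κ : ℝ) (hκ : κ < 0) (h : ℝ → ℝ)
    (hC1 : ContDiffOn ℝ 1 h (Set.Icc (-1 : ℝ) 1))
    (heven : ∀ y ∈ Set.Icc (-1 : ℝ) 1, h (-y) = h y)
    (hpos : ∀ y ∈ Set.Icc (-1 : ℝ) 1, 0 < h y)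
    (hadm : ∀ y ∈ Set.Icc (-1 : ℝ) 1, 0 < 4 * h y ^ 2 + κ * (1 - y ^ 2)) :
    ∀ y ∈ Set.Ioo (-1 : ℝ) 1,
      0 < κ * (1 - y ^ 2) + 8 * h y ^ 2
          - 4 * h y * Real.sqrt (4 * h y ^ 2 + κ * (1 - y ^ 2)) ∧
      2 / Real.sqrt (-κ) <
        2 * Real.sqrt ((1 - y ^ 2) /
          (κ * (1 - y ^ 2) + 8 * h y ^ 2
            - 4 * h y * Real.sqrt (4 * h y ^ 2 + κ * (1 - y ^ 2)))) := by
  intro y hy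
  have hyI := Set.Ioo_subset_Icc_self hy
  have hs : 0 < 1 - y ^ 2 := by nlinarith [hy.1, hy.2]
  have hh := hpos y hyI
  have hr : 0 < √(4 * h y ^ 2 + κ * (1 - y ^ 2)) := Real.sqrt_pos.mpr (hadm y hyI)
  have hrsq := Real.sq_sqrt (hadm y hyI).le
  set r := √(4 * h y ^ 2 + κ * (1 - y ^ 2))
  have hκs : κ * (1 - y ^ 2) < 0 := mul_neg_of_neg_of_pos hκ hs
  have hr_lt : r < 2 * h y := by nlinarith
  have hden : κ * (1 - y ^ 2) + 8 * h y ^ 2 - 4 * h y * r = (2 * h y - r) ^ 2 := by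
    linear_combination -hrsq
  have hD : 0 < (2 * h y - r) ^ 2 := pow_pos (sub_pos.mpr hr_lt) 2
  rw [hden]
  refine ⟨hD, ?_⟩
  rw [div_eq_mul_inv, ← Real.sqrt_inv]
  gcongr
  · exact inv_nonneg.mpr (neg_nonneg.mpr hκ.le)
  rw [inv_eq_one_div, div_lt_div_iff₀ (neg_pos.mpr hκ) hD]
  nlinarith [mul_pos hr (sub_pos.mpr hr_lt)]
end

section
/- Let κ, τ be real numbers and let h : [−1,1] → ℝ be C¹, even (h(−y) = h(y)), strictly positive, and satisfy 4h(y)² + κ(1−y²) > 0 for all y ∈ [−1,1]. For y ∈ (−1,1), let D₁(y) := κ(1−y²) + 8(h(y)² + τ²y²) + 4·h(y)·√(4h(y)² + κ(1−y²) + 4τ²y²) and x := Γ₁(y) := 2·√((1−y²)/D₁(y)). Then D₁(y) > 0, (1+τ²x²)·y² < 1, and the stationarity equation 4 − κx² − y²(4 − x²(κ − 8τ²)) = 8·x·h(y)·√(1 − (1+τ²x²)y²) holds. -/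
/-- For `h ∈ 𝔠¹` and `y ∈ (−1,1)`, the explicit formula `x = Γ₁(y)` has positive
denominator, lies strictly inside the admissible region `(1+τ²x²)y² < 1`, and solves the
stationarity equation `4 − κx² − y²(4 − x²(κ−8τ²)) = 8·x·h(y)·√(1 − (1+τ²x²)y²)`. -/
theorem Gamma1_stationarity (κ τ : ℝ) (h : ℝ → ℝ)
    (hC1 : ContDiffOn ℝ 1 h (Set.Icc (-1 : ℝ) 1))
    (heven : ∀ y ∈ Set.Icc (-1 : ℝ) 1, h (-y) = h y)
    (hpos : ∀ y ∈ Set.Icc (-1 : ℝ) 1, 0 < h y)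
    (hadm : ∀ y ∈ Set.Icc (-1 : ℝ) 1, 0 < 4 * h y ^ 2 + κ * (1 - y ^ 2)) :
    ∀ y ∈ Set.Ioo (-1 : ℝ) 1,
      let D : ℝ := κ * (1 - y ^ 2) + 8 * (h y ^ 2 + τ ^ 2 * y ^ 2)
        + 4 * h y * Real.sqrt (4 * h y ^ 2 + κ * (1 - y ^ 2) + 4 * τ ^ 2 * y ^ 2)
      let x : ℝ := 2 * Real.sqrt ((1 - y ^ 2) / D)
      0 < D ∧ (1 + τ ^ 2 * x ^ 2) * y ^ 2 < 1 ∧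
        4 - κ * x ^ 2 - y ^ 2 * (4 - x ^ 2 * (κ - 8 * τ ^ 2)) =
          8 * x * h y * Real.sqrt (1 - (1 + τ ^ 2 * x ^ 2) * y ^ 2) := by
  intro y hy D x
  have hyI : y ∈ Set.Icc (-1 : ℝ) 1 := Set.Ioo_subset_Icc_self hy
  have hH := hpos y hyI
  have hu : 0 < 1 - y ^ 2 := by nlinarith [hy.1, hy.2]
  have hT : 0 ≤ τ ^ 2 * y ^ 2 := by positivity
  have hQ : 0 ≤ 4 * h y ^ 2 + κ * (1 - y ^ 2) + 4 * τ ^ 2 * y ^ 2 := by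
    linarith [hadm y hyI]
  obtain ⟨S, hS⟩ : ∃ S, S = √(4 * h y ^ 2 + κ * (1 - y ^ 2) + 4 * τ ^ 2 * y ^ 2) := ⟨_, rfl⟩
  have hS0 : 0 ≤ S := hS ▸ Real.sqrt_nonneg _
  have hS2 : S ^ 2 = 4 * h y ^ 2 + κ * (1 - y ^ 2) + 4 * τ ^ 2 * y ^ 2 := by
    rw [hS, Real.sq_sqrt hQ]
  have hDS : D = κ * (1 - y ^ 2) + 8 * (h y ^ 2 + τ ^ 2 * y ^ 2) + 4 * h y * S := by rw [hS]
  have hD : D = (S + 2 * h y) ^ 2 + 4 * (τ ^ 2 * y ^ 2) := by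
    rw [hDS]; linear_combination -hS2
  have hDpos : 0 < D := by rw [hD]; positivity
  obtain ⟨r, hr⟩ : ∃ r, r = √((1 - y ^ 2) / D) := ⟨_, rfl⟩
  have hx : x = 2 * r := by rw [hr]
  have hr0 : 0 < r := hr ▸ Real.sqrt_pos.2 (div_pos hu hDpos)
  have hrD : r ^ 2 * D = 1 - y ^ 2 := by
    rw [hr, Real.sq_sqrt (div_pos hu hDpos).le, div_mul_cancel₀ _ hDpos.ne']
  have hgap : 1 - (1 + τ ^ 2 * x ^ 2) * y ^ 2 = (r * (S + 2 * h y)) ^ 2 := by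
    rw [hx]; linear_combination r ^ 2 * hD - hrD
  refine ⟨hDpos, ?_, ?_⟩
  · have : 0 < (r * (S + 2 * h y)) ^ 2 := by positivity
    linarith
  · rw [hgap, Real.sqrt_sq (by positivity), hx]
    linear_combination 4 * r ^ 2 * hDS - 4 * hrD
end

section
/- Let κ < 0, c₁ > 0 and x₀ ∈ (0, 2/√(−κ)). There is no differentiable function θ : [x₀, 2/√(−κ)) → ℝ such that θ'(x)·cos(θ(x)) ≥ c₁/(4 + κx²) for all x ∈ [x₀, 2/√(−κ)). Indeed, any such function would satisfy sin(θ(x)) ≥ (c₁/(2√(−κ)))·artanh(√(−κ)·x/2) − (c₁/(2√(−κ)))·artanh(√(−κ)·x₀/2) + sin(θ(x₀)) for all x, and the right-hand side tends to +∞ as x → 2/√(−κ), contradicting the boundedness of the sine function. -/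
/-- The inverse hyperbolic tangent, `artanh x = (1/2)·log((1+x)/(1−x))`. -/
noncomputable def Real.artanh' (x : ℝ) : ℝ := (1 / 2) * Real.log ((1 + x) / (1 - x))

theorem Real.hasDerivAt_artanh' {y : ℝ} (h₁ : -1 < y) (h₂ : y < 1) :
    HasDerivAt Real.artanh' (1 / (1 - y ^ 2)) y := by
  have hp : 1 + y ≠ 0 := by linarith
  have hm : 1 - y ≠ 0 := by linarith
  have hq : HasDerivAt (fun y : ℝ => (1 + y) / (1 - y))
      ((1 * (1 - y) - (1 + y) * (-1)) / (1 - y) ^ 2) y :=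
    ((hasDerivAt_id' y).const_add 1).fun_div ((hasDerivAt_id' y).const_sub 1) hm
  have h := (hq.log (div_ne_zero hp hm)).const_mul (1 / 2)
  refine h.congr_deriv ?_
  have hf : 1 - y ^ 2 = (1 + y) * (1 - y) := by ring
  rw [hf]
  field_simp
  ring

theorem Real.tendsto_artanh'_nhdsLT_one :
    Filter.Tendsto Real.artanh' (nhdsWithin 1 (Set.Iio 1)) Filter.atTop := by
  have hm : Filter.Tendsto (fun y : ℝ => 1 - y) (nhdsWithin 1 (Set.Iio 1))
      (nhdsWithin 0 (Set.Ioi 0)) := by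
    refine tendsto_nhdsWithin_iff.2 ⟨?_, ?_⟩
    · have h : Filter.Tendsto (fun y : ℝ => 1 - y) (nhds 1) (nhds (1 - 1)) :=
        (continuous_const.sub continuous_id).tendsto 1
      rw [sub_self] at h
      exact h.mono_left nhdsWithin_le_nhds
    · filter_upwards [self_mem_nhdsWithin] with y hy
      exact sub_pos.2 (Set.mem_Iio.1 hy)
  have hp : Filter.Tendsto (fun y : ℝ => 1 + y) (nhdsWithin 1 (Set.Iio 1)) (nhds (1 + 1)) :=
    ((continuous_const.add continuous_id).tendsto (1 : ℝ)).mono_left nhdsWithin_le_nhds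
  have hq : Filter.Tendsto (fun y : ℝ => (1 + y) / (1 - y)) (nhdsWithin 1 (Set.Iio 1))
      Filter.atTop := by
    simpa only [div_eq_mul_inv, Function.comp_def] using
      hp.pos_mul_atTop (by norm_num) (tendsto_inv_nhdsGT_zero.comp hm)
  exact (Real.tendsto_log_atTop.comp hq).const_mul_atTop (by norm_num)

theorem tendsto_mul_artanh' {s c : ℝ} (hs : 0 < s) (hc : 0 < c) :
    Filter.Tendsto (fun x : ℝ => c / (2 * s) * Real.artanh' (s * x / 2))
      (nhdsWithin (2 / s) (Set.Iio (2 / s))) Filter.atTop := by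
  have hl : Filter.Tendsto (fun x : ℝ => s * x / 2) (nhdsWithin (2 / s) (Set.Iio (2 / s)))
      (nhdsWithin 1 (Set.Iio 1)) := by
    refine tendsto_nhdsWithin_iff.2 ⟨?_, ?_⟩
    · have h : Filter.Tendsto (fun x : ℝ => s * x / 2) (nhds (2 / s)) (nhds (s * (2 / s) / 2)) :=
        ((continuous_const.mul continuous_id).div_const 2).tendsto _
      have he : s * (2 / s) / 2 = 1 := by field_simp
      rw [he] at h
      exact h.mono_left nhdsWithin_le_nhds
    · filter_upwards [self_mem_nhdsWithin] with x hx
      have := (lt_div_iff₀ hs).1 hx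
      show s * x / 2 < 1
      linarith
  exact (Real.tendsto_artanh'_nhdsLT_one.comp hl).const_mul_atTop (by positivity)

theorem hasDerivAt_mul_artanh' {s c x : ℝ} (hs : 0 < s) (hx : 0 < x) (hx' : x < 2 / s) :
    HasDerivAt (fun x : ℝ => c / (2 * s) * Real.artanh' (s * x / 2))
      (c / (4 - s ^ 2 * x ^ 2)) x := by
  have hsx : x * s < 2 := (lt_div_iff₀ hs).1 hx'
  have hsx₀ : 0 < x * s := mul_pos hx hs
  have hl : HasDerivAt (fun x : ℝ => s * x / 2) (s * 1 / 2) x :=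
    ((hasDerivAt_id' x).const_mul s).div_const 2
  have h := ((Real.hasDerivAt_artanh' (y := s * x / 2) (by linarith) (by linarith)).comp x
    hl).const_mul (c / (2 * s))
  refine h.congr_deriv ?_
  have h₁ : 4 - s ^ 2 * x ^ 2 ≠ 0 := by nlinarith
  have h₂ : 1 - (s * x / 2) ^ 2 = (4 - s ^ 2 * x ^ 2) / 4 := by ring
  rw [h₂]
  field_simp
  ring

theorem mul_artanh'_le_sin {s c x₀ : ℝ} (hs : 0 < s) (hx₀ : 0 < x₀) {θ θ' : ℝ → ℝ}
    (hθ : ∀ x ∈ Set.Ico x₀ (2 / s), HasDerivWithinAt θ (θ' x) (Set.Ico x₀ (2 / s)) x)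
    (hle : ∀ x ∈ Set.Ico x₀ (2 / s), c / (4 - s ^ 2 * x ^ 2) ≤ θ' x * Real.cos (θ x))
    {x : ℝ} (hx : x ∈ Set.Ico x₀ (2 / s)) :
    c / (2 * s) * Real.artanh' (s * x / 2) - c / (2 * s) * Real.artanh' (s * x₀ / 2)
      + Real.sin (θ x₀) ≤ Real.sin (θ x) := by
  have hd : ∀ y ∈ Set.Ico x₀ (2 / s), HasDerivWithinAt
      (fun y => Real.sin (θ y) - c / (2 * s) * Real.artanh' (s * y / 2))
      (Real.cos (θ y) * θ' y - c / (4 - s ^ 2 * y ^ 2)) (Set.Ico x₀ (2 / s)) y :=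
    fun y hy => (hθ y hy).sin.sub
      (hasDerivAt_mul_artanh' hs (hx₀.trans_le hy.1) hy.2).hasDerivWithinAt
  have hmono := monotoneOn_of_hasDerivWithinAt_nonneg (convex_Ico x₀ (2 / s))
    (fun y hy => (hd y hy).continuousWithinAt)
    (fun y hy => (hd y (interior_subset hy)).mono interior_subset)
    (fun y hy => by linarith [hle y (interior_subset hy), mul_comm (θ' y) (Real.cos (θ y))])
  have h := hmono ⟨le_rfl, hx.1.trans_lt hx.2⟩ hx hx.1
  dsimp only at h
  linarith

/-- For `κ < 0`, `c₁ > 0` and `x₀ ∈ (0, 2/√(−κ))`, there is no differentiable function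
`θ : [x₀, 2/√(−κ)) → ℝ` with `θ'(x)·cos(θ(x)) ≥ c₁/(4+κx²)`. Indeed any such function
would satisfy `sin(θ(x)) ≥ (c₁/(2√(−κ)))·(artanh(√(−κ)x/2) − artanh(√(−κ)x₀/2)) + sin(θ(x₀))`,
whose right-hand side tends to `+∞` as `x → 2/√(−κ)⁻`. -/
theorem no_theta_artanh_growth (κ c₁ x₀ : ℝ) (hκ : κ < 0) (hc : 0 < c₁)
    (hx₀ : x₀ ∈ Set.Ioo (0 : ℝ) (2 / Real.sqrt (-κ))) :
    (¬ ∃ θ θ' : ℝ → ℝ,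
        (∀ x ∈ Set.Ico x₀ (2 / Real.sqrt (-κ)),
          HasDerivWithinAt θ (θ' x) (Set.Ico x₀ (2 / Real.sqrt (-κ))) x) ∧
        (∀ x ∈ Set.Ico x₀ (2 / Real.sqrt (-κ)),
          c₁ / (4 + κ * x ^ 2) ≤ θ' x * Real.cos (θ x))) ∧
    (∀ θ θ' : ℝ → ℝ,
      (∀ x ∈ Set.Ico x₀ (2 / Real.sqrt (-κ)),
        HasDerivWithinAt θ (θ' x) (Set.Ico x₀ (2 / Real.sqrt (-κ))) x) →
      (∀ x ∈ Set.Ico x₀ (2 / Real.sqrt (-κ)),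
        c₁ / (4 + κ * x ^ 2) ≤ θ' x * Real.cos (θ x)) →
      ∀ x ∈ Set.Ico x₀ (2 / Real.sqrt (-κ)),
        c₁ / (2 * Real.sqrt (-κ)) * Real.artanh' (Real.sqrt (-κ) * x / 2)
          - c₁ / (2 * Real.sqrt (-κ)) * Real.artanh' (Real.sqrt (-κ) * x₀ / 2)
          + Real.sin (θ x₀) ≤ Real.sin (θ x)) ∧
    Filter.Tendsto
      (fun x : ℝ => c₁ / (2 * Real.sqrt (-κ)) * Real.artanh' (Real.sqrt (-κ) * x / 2))
      (nhdsWithin (2 / Real.sqrt (-κ)) (Set.Iio (2 / Real.sqrt (-κ)))) Filter.atTop := by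
  have hs : 0 < Real.sqrt (-κ) := Real.sqrt_pos.2 (neg_pos.2 hκ)
  have hden (x : ℝ) : 4 + κ * x ^ 2 = 4 - Real.sqrt (-κ) ^ 2 * x ^ 2 := by
    rw [Real.sq_sqrt (neg_pos.2 hκ).le]
    ring
  simp only [hden]
  have hlim := tendsto_mul_artanh' hs hc
  refine ⟨?_, fun θ θ' hθ hle x hx => mul_artanh'_le_sin hs hx₀.1 hθ hle hx, hlim⟩
  rintro ⟨θ, θ', hθ, hle⟩
  obtain ⟨x, hx, hx'⟩ := ((hlim.eventually_gt_atTop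
    (c₁ / (2 * Real.sqrt (-κ)) * Real.artanh' (Real.sqrt (-κ) * x₀ / 2) + 2)).and
      (Ico_mem_nhdsLT hx₀.2)).exists
  have h := mul_artanh'_le_sin hs hx₀.1 hθ hle hx'
  linarith [Real.neg_one_le_sin (θ x₀), Real.sin_le_one (θ x)]
end

section
/- Let κ < 0 and τ ≥ 0 be real numbers, and let h : [−1,1] → ℝ be C¹, even (h(−y) = h(y)), strictly positive, and satisfy 4h(y)² + κ(1−y²) > 0 for all y ∈ [−1,1]. Let s₀ ∈ (0, ∞] and let x, θ : [0, s₀) → ℝ be differentiable functions satisfying, for all s ∈ [0, s₀): x'(s) = cos(θ(s))/√(1 + τ²x(s)²) and θ'(s) = (1/((4 + κx(s)²)·√(1 + τ²x(s)²)))·(8·h(cos(θ(s))/√(1 + τ²x(s)²)) − ((4 − κx(s)²)/x(s))·sin(θ(s))), together with 0 < x(s) < 2/√(−κ), θ(s) ∈ [0, π/2], and x'(s) > 0. Then x(s) does not tend to 2/√(−κ) as s → s₀. -/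
open Filter Topology Set

/-- The admissibility condition `4 h(y)² > k² (1 - y²)` holds with a uniform margin. -/
lemma exists_uniform_margin {h : ℝ → ℝ} {k : ℝ}
    (hcont : ContinuousOn h (Icc (-1) 1))
    (hpos : ∀ y ∈ Icc (-1 : ℝ) 1, 0 < h y)
    (hadm : ∀ y ∈ Icc (-1 : ℝ) 1, 0 < 4 * h y ^ 2 + -k ^ 2 * (1 - y ^ 2)) :
    ∃ m > 0, ∀ y ∈ Icc (-1 : ℝ) 1, m ≤ 2 * h y - k * √(1 - y ^ 2) := by
  have hf : ContinuousOn (fun y ↦ 2 * h y - k * √(1 - y ^ 2)) (Icc (-1) 1) :=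
    (hcont.const_smul (2 : ℝ)).sub (by fun_prop)
  obtain ⟨y₀, hy₀, hmin⟩ := isCompact_Icc.exists_isMinOn ⟨0, by norm_num⟩ hf
  refine ⟨_, ?_, fun y hy ↦ hmin hy⟩
  have hsq : √(1 - y₀ ^ 2) ^ 2 = 1 - y₀ ^ 2 :=
    Real.sq_sqrt (by nlinarith [hy₀.1, hy₀.2])
  have : k * √(1 - y₀ ^ 2) < 2 * h y₀ := by
    refine lt_of_pow_lt_pow_left₀ 2 (by linarith [hpos y₀ hy₀]) ?_
    rw [mul_pow, hsq]
    linarith [hadm y₀ hy₀]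
  exact sub_pos.2 this

/-- A lower bound for the bracket in the equation for `θ'`, valid for `x` close to `2 / k`. -/
lemma bracket_lower_bound {h : ℝ → ℝ} {k m τ x θ : ℝ} (hk : 0 < k) (hm : 0 < m)
    (hmargin : ∀ y ∈ Icc (-1 : ℝ) 1, m ≤ 2 * h y - k * √(1 - y ^ 2))
    (hx : (4 - -k ^ 2 * x ^ 2) / x < 4 * k + 2 * m) (hsin : 0 ≤ Real.sin θ) :
    2 * m ≤ 8 * h (Real.cos θ / √(1 + τ ^ 2 * x ^ 2)) -
      (4 - -k ^ 2 * x ^ 2) / x * Real.sin θ := by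
  set W := √(1 + τ ^ 2 * x ^ 2)
  have hW : 1 ≤ W := Real.one_le_sqrt.2 (by nlinarith [sq_nonneg (τ * x)])
  have hν : (Real.cos θ / W) ^ 2 ≤ Real.cos θ ^ 2 := by
    rw [div_pow]
    exact div_le_self (sq_nonneg _) (one_le_pow₀ hW)
  have hmem : Real.cos θ / W ∈ Icc (-1 : ℝ) 1 :=
    abs_le.1 ((sq_le_one_iff_abs_le_one _).1 (hν.trans (Real.cos_sq_le_one θ)))
  have hsqrt : Real.sin θ ≤ √(1 - (Real.cos θ / W) ^ 2) :=
    Real.le_sqrt_of_sq_le (by linarith [Real.sin_sq_add_cos_sq θ])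
  have h1 := hmargin _ hmem
  have h2 := mul_le_mul_of_nonneg_left hsqrt hk.le
  have h3 := mul_le_mul_of_nonneg_right hx.le hsin
  nlinarith [Real.sin_le_one θ]

/-- The profile curve equations on a convex set `I` of parameters: `x` cannot converge to `2 / k`
along a filter `l` that tends to the right end of `I`. -/
lemma not_tendsto_boundary {h x θ : ℝ → ℝ} {k m τ : ℝ} (hk : 0 < k) (hm : 0 < m)
    (hmargin : ∀ y ∈ Icc (-1 : ℝ) 1, m ≤ 2 * h y - k * √(1 - y ^ 2))
    {I : Set ℝ} (hI : Convex ℝ I) {l : Filter ℝ} [l.NeBot] (hlI : ∀ᶠ s in l, s ∈ I)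
    (hl : ∀ a ∈ I, ∀ᶠ s in l, a ≤ s)
    (hode : ∀ s ∈ I,
      HasDerivAt x (Real.cos (θ s) / √(1 + τ ^ 2 * x s ^ 2)) s ∧
      HasDerivAt θ ((1 / ((4 + -k ^ 2 * x s ^ 2) * √(1 + τ ^ 2 * x s ^ 2))) *
        (8 * h (Real.cos (θ s) / √(1 + τ ^ 2 * x s ^ 2))
          - ((4 - -k ^ 2 * x s ^ 2) / x s) * Real.sin (θ s))) s ∧
      0 < x s ∧ x s < 2 / k ∧ θ s ∈ Icc (0 : ℝ) (Real.pi / 2) ∧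
      0 < Real.cos (θ s) / √(1 + τ ^ 2 * x s ^ 2)) :
    ¬ Tendsto x l (𝓝 (2 / k)) := by
  intro hlim
  have hnear : ∀ᶠ u in 𝓝 (2 / k), (4 - -k ^ 2 * u ^ 2) / u < 4 * k + 2 * m := by
    have hc : ContinuousAt (fun u : ℝ ↦ (4 - -k ^ 2 * u ^ 2) / u) (2 / k) :=
      ContinuousAt.div (by fun_prop) continuousAt_id (by positivity)
    refine hc.eventually_lt_const ?_
    have : (4 - -k ^ 2 * (2 / k) ^ 2) / (2 / k) = 4 * k := by field_simp; ring
    simp only [this]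
    linarith
  obtain ⟨b, hb, hbsub⟩ := exists_Ioc_subset_of_mem_nhds hnear ⟨0, by simpa using hk⟩
  obtain ⟨a, hbx, haI⟩ := ((hlim.eventually_const_lt hb).and hlI).exists
  have hmono : MonotoneOn x I :=
    monotoneOn_of_hasDerivWithinAt_nonneg hI
      (fun s hs ↦ (hode s hs).1.continuousAt.continuousWithinAt)
      (fun s hs ↦ (hode s (interior_subset hs)).1.hasDerivWithinAt)
      (fun s hs ↦ (hode s (interior_subset hs)).2.2.2.2.2.le)
  set c := m / (2 * k)
  have hc : 0 < c := by positivity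
  have hG : ∀ s ∈ I, HasDerivAt (fun s ↦ Real.sin (θ s) + c * Real.log (2 / k - x s))
      (Real.cos (θ s) * ((1 / ((4 + -k ^ 2 * x s ^ 2) * √(1 + τ ^ 2 * x s ^ 2))) *
        (8 * h (Real.cos (θ s) / √(1 + τ ^ 2 * x s ^ 2))
          - ((4 - -k ^ 2 * x s ^ 2) / x s) * Real.sin (θ s))) +
        c * (-(Real.cos (θ s) / √(1 + τ ^ 2 * x s ^ 2)) / (2 / k - x s))) s := fun s hs ↦ by
    obtain ⟨hx, hθ, -, hlt, -⟩ := hode s hs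
    exact hθ.sin.add (((hx.const_sub (2 / k)).log (sub_pos.2 hlt).ne').const_mul c)
  have hGmono : MonotoneOn (fun s ↦ Real.sin (θ s) + c * Real.log (2 / k - x s))
      (I ∩ Ici a) := by
    refine monotoneOn_of_hasDerivWithinAt_nonneg (hI.inter (convex_Ici a))
      (fun s hs ↦ (hG s hs.1).continuousAt.continuousWithinAt)
      (fun s hs ↦ (hG s (interior_subset hs).1).hasDerivWithinAt) (fun s hs ↦ ?_)
    obtain ⟨hsI, has⟩ := interior_subset hs
    obtain ⟨-, -, hx0, hlt, hθ, hx'⟩ := hode s hsI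
    have hB := bracket_lower_bound (τ := τ) hk hm hmargin
      (hbsub ⟨hbx.trans_le (hmono haI hsI has), hlt.le⟩)
      (Real.sin_nonneg_of_nonneg_of_le_pi hθ.1 (by linarith [hθ.2, Real.pi_pos]))
    set B := 8 * h (Real.cos (θ s) / √(1 + τ ^ 2 * x s ^ 2)) -
      (4 - -k ^ 2 * x s ^ 2) / x s * Real.sin (θ s)
    have hd : 0 < 2 / k - x s := sub_pos.2 hlt
    have hkx : k * x s < 2 := by rwa [lt_div_iff₀ hk, mul_comm] at hlt
    have hfac : 4 + -k ^ 2 * x s ^ 2 = k * (2 / k - x s) * (2 + k * x s) := by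
      field_simp; ring
    have hD : 0 < 4 + -k ^ 2 * x s ^ 2 := by rw [hfac]; positivity
    have hle : 4 + -k ^ 2 * x s ^ 2 ≤ 4 * k * (2 / k - x s) := by
      rw [hfac]; nlinarith [mul_pos hk hd]
    have hkey : c / (2 / k - x s) ≤ B / (4 + -k ^ 2 * x s ^ 2) :=
      calc c / (2 / k - x s) = 2 * m / (4 * k * (2 / k - x s)) := by
            rw [← div_div]; congr 1; simp only [c]; field_simp; norm_num
        _ ≤ B / (4 + -k ^ 2 * x s ^ 2) := by gcongr; linarith
    calc (0 : ℝ) ≤ Real.cos (θ s) / √(1 + τ ^ 2 * x s ^ 2) *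
          (B / (4 + -k ^ 2 * x s ^ 2) - c / (2 / k - x s)) :=
            mul_nonneg hx'.le (sub_nonneg.2 hkey)
      _ = _ := by rw [one_div, mul_inv]; ring
  have hlog : Tendsto (fun s ↦ Real.log (2 / k - x s)) l atBot := by
    refine Real.tendsto_log_nhdsGT_zero.comp (tendsto_nhdsWithin_iff.2 ⟨?_, ?_⟩)
    · simpa using hlim.const_sub (2 / k)
    · filter_upwards [hlI] with s hs using sub_pos.2 (hode s hs).2.2.2.1
  obtain ⟨s, hs, hsI, has⟩ := (((hlog.const_mul_atBot hc).eventually_lt_atBot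
    (Real.sin (θ a) + c * Real.log (2 / k - x a) - 1)).and (hlI.and (hl a haI))).exists
  have := hGmono ⟨haI, le_refl a⟩ ⟨hsI, has⟩ has
  simp only at this
  linarith [Real.sin_le_one (θ s)]


/-- For `κ < 0`, `τ ≥ 0` and `h ∈ 𝔠¹`, the distance function `x(s)` of an arc-length
parametrized profile curve of a rotational `h`-surface in `E(κ,τ)`, whose phase-plane
orbit lies in the monotonicity region `Λ₁⁺` (i.e. `θ ∈ [0, π/2]` and `x' > 0`), cannot
tend to the limiting value `2/√(−κ)` as `s → s₀`, for any `s₀ ∈ (0, ∞]` (the two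
conjuncts treat `s₀` finite and `s₀ = ∞`). -/
theorem x_cannot_reach_boundary (κ τ : ℝ) (hκ : κ < 0) (hτ : 0 ≤ τ) (h : ℝ → ℝ)
    (hC1 : ContDiffOn ℝ 1 h (Set.Icc (-1 : ℝ) 1))
    (heven : ∀ y ∈ Set.Icc (-1 : ℝ) 1, h (-y) = h y)
    (hpos : ∀ y ∈ Set.Icc (-1 : ℝ) 1, 0 < h y)
    (hadm : ∀ y ∈ Set.Icc (-1 : ℝ) 1, 0 < 4 * h y ^ 2 + κ * (1 - y ^ 2)) :
    (∀ s₀ : ℝ, 0 < s₀ → ∀ x θ : ℝ → ℝ,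
      (∀ s ∈ Set.Ico (0 : ℝ) s₀,
        HasDerivAt x (Real.cos (θ s) / Real.sqrt (1 + τ ^ 2 * x s ^ 2)) s ∧
        HasDerivAt θ ((1 / ((4 + κ * x s ^ 2) * Real.sqrt (1 + τ ^ 2 * x s ^ 2))) *
          (8 * h (Real.cos (θ s) / Real.sqrt (1 + τ ^ 2 * x s ^ 2))
            - ((4 - κ * x s ^ 2) / x s) * Real.sin (θ s))) s ∧
        0 < x s ∧ x s < 2 / Real.sqrt (-κ) ∧
        θ s ∈ Set.Icc (0 : ℝ) (Real.pi / 2) ∧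
        0 < Real.cos (θ s) / Real.sqrt (1 + τ ^ 2 * x s ^ 2)) →
      ¬ Filter.Tendsto x (nhdsWithin s₀ (Set.Ico (0 : ℝ) s₀))
          (nhds (2 / Real.sqrt (-κ)))) ∧
    (∀ x θ : ℝ → ℝ,
      (∀ s ∈ Set.Ici (0 : ℝ),
        HasDerivAt x (Real.cos (θ s) / Real.sqrt (1 + τ ^ 2 * x s ^ 2)) s ∧
        HasDerivAt θ ((1 / ((4 + κ * x s ^ 2) * Real.sqrt (1 + τ ^ 2 * x s ^ 2))) *
          (8 * h (Real.cos (θ s) / Real.sqrt (1 + τ ^ 2 * x s ^ 2))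
            - ((4 - κ * x s ^ 2) / x s) * Real.sin (θ s))) s ∧
        0 < x s ∧ x s < 2 / Real.sqrt (-κ) ∧
        θ s ∈ Set.Icc (0 : ℝ) (Real.pi / 2) ∧
        0 < Real.cos (θ s) / Real.sqrt (1 + τ ^ 2 * x s ^ 2)) →
      ¬ Filter.Tendsto x Filter.atTop (nhds (2 / Real.sqrt (-κ)))) := by
  obtain ⟨k, hk, rfl⟩ : ∃ k : ℝ, 0 < k ∧ κ = -k ^ 2 :=
    ⟨√(-κ), Real.sqrt_pos.2 (by linarith), by rw [Real.sq_sqrt (by linarith)]; ring⟩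
  obtain ⟨m, hm, hmargin⟩ := exists_uniform_margin hC1.continuousOn hpos hadm
  rw [neg_neg, Real.sqrt_sq hk.le]
  refine ⟨fun s₀ hs₀ x θ hode ↦ ?_, fun x θ hode ↦ ?_⟩
  · have : (𝓝[Ico 0 s₀] s₀).NeBot := by
      rw [nhdsWithin_Ico_eq_nhdsLT hs₀]; infer_instance
    exact not_tendsto_boundary hk hm hmargin (convex_Ico 0 s₀) self_mem_nhdsWithin
      (fun a ha ↦ mem_nhdsWithin_of_mem_nhds (Ici_mem_nhds ha.2)) hode
  · exact not_tendsto_boundary hk hm hmargin (convex_Ici 0) (eventually_ge_atTop 0)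
      (fun a _ ↦ eventually_ge_atTop a) hode
end

section
/- Let κ ≤ 0 and τ > 0 be real numbers, and let h : [−1,1] → ℝ be strictly positive and non-increasing on [−1, 0]. Let θ₁ ∈ (π/2, π) and θ₂ ∈ (π, 3π/2) with sin(θ₁) = −sin(θ₂), and let x₁ > x₂ > 0 be real numbers with x₁ < 2/√(−κ) in case κ < 0. Set f(x) := (4 − κx²)/x and ν_i := cos(θ_i)/√(1 + τ²x_i²) for i = 1, 2, and assume 8·h(ν₁) − f(x₁)·sin(θ₁) > 0. Then 8·h(ν₂) − f(x₂)·sin(θ₂) > 0, and the strict inequality (−4·sin(θ₂)·√(1 + τ²x₂²))/(8·h(ν₂) − f(x₂)·sin(θ₂)) < (4·sin(θ₁)·√(1 + τ²x₁²))/(8·h(ν₁) − f(x₁)·sin(θ₁)) holds. -/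
/-- The central pointwise inequality in the proof of non-existence of rotational `h`-tori
in `Nil₃` and the universal cover of `SL₂(ℝ)`: for `κ ≤ 0`, `τ > 0`, `h` positive and
non-increasing on `[−1,0]`, comparing `−dz/dθ` on the lower quarter of a nodoid arc with
`dz/dθ` on the upper quarter. -/
theorem nodoid_height_inequality (κ τ θ₁ θ₂ x₁ x₂ : ℝ) (hκ : κ ≤ 0) (hτ : 0 < τ)
    (h : ℝ → ℝ) (hpos : ∀ y ∈ Set.Icc (-1 : ℝ) 1, 0 < h y)
    (hmono : AntitoneOn h (Set.Icc (-1 : ℝ) 0))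
    (hθ₁ : θ₁ ∈ Set.Ioo (Real.pi / 2) Real.pi)
    (hθ₂ : θ₂ ∈ Set.Ioo Real.pi (3 * Real.pi / 2))
    (hsin : Real.sin θ₁ = -Real.sin θ₂)
    (hx₂ : 0 < x₂) (hx : x₂ < x₁)
    (hxb : κ < 0 → x₁ < 2 / Real.sqrt (-κ))
    (hden₁ : 0 < 8 * h (Real.cos θ₁ / Real.sqrt (1 + τ ^ 2 * x₁ ^ 2))
        - ((4 - κ * x₁ ^ 2) / x₁) * Real.sin θ₁) :
    0 < 8 * h (Real.cos θ₂ / Real.sqrt (1 + τ ^ 2 * x₂ ^ 2))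
        - ((4 - κ * x₂ ^ 2) / x₂) * Real.sin θ₂ ∧
    (-4 * Real.sin θ₂ * Real.sqrt (1 + τ ^ 2 * x₂ ^ 2)) /
        (8 * h (Real.cos θ₂ / Real.sqrt (1 + τ ^ 2 * x₂ ^ 2))
          - ((4 - κ * x₂ ^ 2) / x₂) * Real.sin θ₂) <
      (4 * Real.sin θ₁ * Real.sqrt (1 + τ ^ 2 * x₁ ^ 2)) /
        (8 * h (Real.cos θ₁ / Real.sqrt (1 + τ ^ 2 * x₁ ^ 2))
          - ((4 - κ * x₁ ^ 2) / x₁) * Real.sin θ₁) := by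
  have hs : 0 < Real.sin θ₁ :=
    Real.sin_pos_of_pos_of_lt_pi (by linarith [hθ₁.1, Real.pi_pos]) hθ₁.2
  have hc : Real.cos θ₁ < 0 :=
    Real.cos_neg_of_pi_div_two_lt_of_lt hθ₁.1 (by linarith [hθ₁.2, Real.pi_pos])
  have hc₂ : Real.cos θ₂ < 0 :=
    Real.cos_neg_of_pi_div_two_lt_of_lt (by linarith [hθ₂.1, Real.pi_pos])
      (by linarith [hθ₂.2])
  have hcos : Real.cos θ₂ = Real.cos θ₁ := by
    have hsq : Real.cos θ₂ ^ 2 = Real.cos θ₁ ^ 2 := by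
      rw [Real.cos_sq', Real.cos_sq', hsin, neg_sq]
    rcases sq_eq_sq_iff_eq_or_eq_neg.mp hsq with h' | h'
    · exact h'
    · linarith
  have hsin₂ : Real.sin θ₂ = -Real.sin θ₁ := by linarith
  rw [hcos, hsin₂]
  set W₁ := Real.sqrt (1 + τ ^ 2 * x₁ ^ 2)
  set W₂ := Real.sqrt (1 + τ ^ 2 * x₂ ^ 2)
  have hW₂ : 1 ≤ W₂ := Real.one_le_sqrt.mpr (by nlinarith [sq_nonneg (τ * x₂)])
  have hW : W₂ < W₁ := Real.sqrt_lt_sqrt (by positivity) (by gcongr)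
  have hν_mem : ∀ W : ℝ, 1 ≤ W → Real.cos θ₁ / W ∈ Set.Icc (-1 : ℝ) 0 := fun W hW' =>
    ⟨by rw [le_div_iff₀ (by linarith)]; linarith [Real.neg_one_le_cos θ₁],
      div_nonpos_of_nonpos_of_nonneg hc.le (by linarith)⟩
  have hν : Real.cos θ₁ / W₂ ≤ Real.cos θ₁ / W₁ := by
    rw [div_le_div_iff₀ (by linarith) (by linarith)]
    nlinarith
  have hh : h (Real.cos θ₁ / W₁) ≤ h (Real.cos θ₁ / W₂) :=
    hmono (hν_mem W₂ hW₂) (hν_mem W₁ (hW₂.trans hW.le)) hν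
  have hf : ∀ x : ℝ, 0 < x → 0 < (4 - κ * x ^ 2) / x * Real.sin θ₁ := fun x hx' =>
    mul_pos (div_pos (by nlinarith [sq_nonneg x]) hx') hs
  have hf₁ := hf x₁ (hx₂.trans hx)
  have hf₂ := hf x₂ hx₂
  have hden : 8 * h (Real.cos θ₁ / W₁) - (4 - κ * x₁ ^ 2) / x₁ * Real.sin θ₁
      < 8 * h (Real.cos θ₁ / W₂) - (4 - κ * x₂ ^ 2) / x₂ * -Real.sin θ₁ := by
    linarith
  refine ⟨hden₁.trans hden, div_lt_div₀ ?_ hden.le (by positivity) hden₁⟩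
  nlinarith
end

section
/- Let κ ≤ 0 and τ > 0 be real numbers, and let h : [−1,1] → ℝ be C¹, even (h(−y) = h(y)), strictly positive, satisfy 4h(y)² + κ(1−y²) > 0 for all y ∈ [−1,1], and be non-increasing on [−1, 0]. Let 0 < s₁ and let x, z, θ : [0, s₁] → ℝ be differentiable functions satisfying, for all s ∈ [0, s₁]: x'(s) = cos(θ(s))/√(1 + τ²x(s)²), z'(s) = 4·sin(θ(s))/(4 + κx(s)²), and θ'(s) = (1/((4 + κx(s)²)·√(1 + τ²x(s)²)))·(8·h(cos(θ(s))/√(1 + τ²x(s)²)) − ((4 − κx(s)²)/x(s))·sin(θ(s))), together with x(s) > 0 (and x(s) < 2/√(−κ) in case κ < 0) and θ'(s) > 0. Assume θ(0) = π/2 and θ(s₁) = 3π/2. Then z(s₁) > z(0). -/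
/-- A right inverse, with values in a compact set, of a map that is continuous and injective on
that set is continuous. -/
theorem IsCompact.continuousOn_of_rightInvOn {α β : Type*} [TopologicalSpace α]
    [TopologicalSpace β] [T2Space β] {f : α → β} {g : β → α} {s : Set α} {t : Set β}
    (hs : IsCompact s) (hfc : ContinuousOn f s) (hf : Set.InjOn f s) (hg : Set.MapsTo g t s)
    (hfg : Set.RightInvOn g f t) : ContinuousOn g t := by
  rw [continuousOn_iff_isClosed]
  intro u hu
  refine ⟨f '' (s ∩ u), ?_, ?_⟩
  · exact ((hs.inter_right hu).image_of_continuousOn (hfc.mono Set.inter_subset_left)).isClosed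
  · ext y
    constructor
    · rintro ⟨hy, hyt⟩
      exact ⟨⟨g y, ⟨hg hyt, hy⟩, hfg hyt⟩, hyt⟩
    · rintro ⟨⟨a, ⟨ha, hau⟩, rfl⟩, hyt⟩
      refine ⟨?_, hyt⟩
      have : g (f a) = a := hf (hg hyt) ha (hfg hyt)
      simpa [this] using hau

/-- The positive slope `dz/dθ` on the outer half of a nodoid arc dominates the absolute value of
the slope on the inner half at the reflected angle. -/
theorem nodoid_slope_add_pos {κ τ S C X Y : ℝ} {h : ℝ → ℝ} (hκ : κ ≤ 0) (hS : 0 < S)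
    (hC : C ≤ 0) (hC1 : -1 ≤ C) (hY : 0 < Y) (hYX : Y ≤ X) (hX4 : 0 < 4 + κ * X ^ 2)
    (hY4 : 0 < 4 + κ * Y ^ 2) (hmono : AntitoneOn h (Set.Icc (-1 : ℝ) 0))
    (hXpos : 0 < (1 / ((4 + κ * X ^ 2) * Real.sqrt (1 + τ ^ 2 * X ^ 2))) *
      (8 * h (C / Real.sqrt (1 + τ ^ 2 * X ^ 2)) - ((4 - κ * X ^ 2) / X) * S)) :
    0 < 4 * (-S) / (4 + κ * Y ^ 2) *
        ((1 / ((4 + κ * Y ^ 2) * Real.sqrt (1 + τ ^ 2 * Y ^ 2))) *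
          (8 * h (C / Real.sqrt (1 + τ ^ 2 * Y ^ 2)) - ((4 - κ * Y ^ 2) / Y) * (-S)))⁻¹ +
      4 * S / (4 + κ * X ^ 2) *
        ((1 / ((4 + κ * X ^ 2) * Real.sqrt (1 + τ ^ 2 * X ^ 2))) *
          (8 * h (C / Real.sqrt (1 + τ ^ 2 * X ^ 2)) - ((4 - κ * X ^ 2) / X) * S))⁻¹ := by
  have hX : 0 < X := hY.trans_le hYX
  have one_le (w : ℝ) : 1 ≤ Real.sqrt (1 + τ ^ 2 * w ^ 2) :=
    Real.one_le_sqrt.2 (by nlinarith [sq_nonneg (τ * w)])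
  have hsqrt : Real.sqrt (1 + τ ^ 2 * Y ^ 2) ≤ Real.sqrt (1 + τ ^ 2 * X ^ 2) := by gcongr
  have mem (w : ℝ) : C / Real.sqrt (1 + τ ^ 2 * w ^ 2) ∈ Set.Icc (-1 : ℝ) 0 := by
    have h1 := one_le w
    constructor
    · rw [le_div_iff₀ (by linarith)]; linarith
    · exact div_nonpos_of_nonpos_of_nonneg hC (by linarith)
  have hν : C / Real.sqrt (1 + τ ^ 2 * Y ^ 2) ≤ C / Real.sqrt (1 + τ ^ 2 * X ^ 2) := by
    have h1 := one_le X
    have h2 := one_le Y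
    rw [div_le_div_iff₀ (by linarith) (by linarith)]
    exact mul_le_mul_of_nonpos_left hsqrt hC
  have hh := hmono (mem Y) (mem X) hν
  have hpX : 0 < (4 - κ * X ^ 2) / X * S := by
    have : 0 ≤ -κ * X ^ 2 := mul_nonneg (by linarith) (sq_nonneg X)
    have : 0 < 4 - κ * X ^ 2 := by linarith
    positivity
  have hpY : 0 < (4 - κ * Y ^ 2) / Y * S := by
    have : 0 ≤ -κ * Y ^ 2 := mul_nonneg (by linarith) (sq_nonneg Y)
    have : 0 < 4 - κ * Y ^ 2 := by linarith
    positivity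
  have h1X := one_le X
  have h1Y := one_le Y
  set p := Real.sqrt (1 + τ ^ 2 * X ^ 2)
  set q := Real.sqrt (1 + τ ^ 2 * Y ^ 2)
  have hp : 0 < p := by linarith
  have hq : 0 < q := by linarith
  have hlt : 8 * h (C / p) - (4 - κ * X ^ 2) / X * S <
      8 * h (C / q) - (4 - κ * Y ^ 2) / Y * (-S) := by linarith
  set D := 8 * h (C / p) - (4 - κ * X ^ 2) / X * S
  set E := 8 * h (C / q) - (4 - κ * Y ^ 2) / Y * (-S)
  have hD : 0 < D := (mul_pos_iff_of_pos_left (by positivity)).1 hXpos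
  have hE : 0 < E := hD.trans hlt
  have key : q / E < p / D := by
    rw [div_lt_div_iff₀ hE hD]
    nlinarith
  have e1 : 4 * (-S) / (4 + κ * Y ^ 2) * ((1 / ((4 + κ * Y ^ 2) * q)) * E)⁻¹ =
      -(4 * S * (q / E)) := by
    field_simp
  have e2 : 4 * S / (4 + κ * X ^ 2) * ((1 / ((4 + κ * X ^ 2) * p)) * D)⁻¹ =
      4 * S * (p / D) := by
    field_simp
  rw [e1, e2]
  nlinarith


/-- Non-existence of rotational `h`-tori in `Nil₃` and the universal cover of `SL₂(ℝ)`: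
for `κ ≤ 0`, `τ > 0` and `h ∈ 𝔠¹` non-increasing on `[−1,0]`, the profile curve
`α(s) = (x(s), 0, z(s))` of a rotational `h`-surface traversing one compact nodoid arc
(from `θ = π/2` to `θ = 3π/2` with `θ' > 0`) has endpoints at different heights:
`z(s₁) > z(0)`, so it never closes up. -/
theorem no_rotational_h_tori (κ τ : ℝ) (hκ : κ ≤ 0) (hτ : 0 < τ) (h : ℝ → ℝ)
    (hC1 : ContDiffOn ℝ 1 h (Set.Icc (-1 : ℝ) 1))
    (heven : ∀ y ∈ Set.Icc (-1 : ℝ) 1, h (-y) = h y)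
    (hpos : ∀ y ∈ Set.Icc (-1 : ℝ) 1, 0 < h y)
    (hadm : ∀ y ∈ Set.Icc (-1 : ℝ) 1, 0 < 4 * h y ^ 2 + κ * (1 - y ^ 2))
    (hmono : AntitoneOn h (Set.Icc (-1 : ℝ) 0))
    (s₁ : ℝ) (hs₁ : 0 < s₁) (x z θ : ℝ → ℝ)
    (hode : ∀ s ∈ Set.Icc (0 : ℝ) s₁,
      HasDerivAt x (Real.cos (θ s) / Real.sqrt (1 + τ ^ 2 * x s ^ 2)) s ∧
      HasDerivAt z (4 * Real.sin (θ s) / (4 + κ * x s ^ 2)) s ∧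
      HasDerivAt θ ((1 / ((4 + κ * x s ^ 2) * Real.sqrt (1 + τ ^ 2 * x s ^ 2))) *
        (8 * h (Real.cos (θ s) / Real.sqrt (1 + τ ^ 2 * x s ^ 2))
          - ((4 - κ * x s ^ 2) / x s) * Real.sin (θ s))) s ∧
      0 < x s ∧ (κ < 0 → x s < 2 / Real.sqrt (-κ)) ∧
      0 < (1 / ((4 + κ * x s ^ 2) * Real.sqrt (1 + τ ^ 2 * x s ^ 2))) *
        (8 * h (Real.cos (θ s) / Real.sqrt (1 + τ ^ 2 * x s ^ 2))
          - ((4 - κ * x s ^ 2) / x s) * Real.sin (θ s)))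
    (hθ0 : θ 0 = Real.pi / 2) (hθs₁ : θ s₁ = 3 * Real.pi / 2) :
    z 0 < z s₁ := by
  have hπ := Real.pi_pos
  have hθcont : ContinuousOn θ (Set.Icc 0 s₁) := fun s hs =>
    (hode s hs).2.2.1.continuousAt.continuousWithinAt
  have hθmono : StrictMonoOn θ (Set.Icc 0 s₁) := by
    refine strictMonoOn_of_deriv_pos (convex_Icc _ _) hθcont fun s hs => ?_
    have hs' := interior_subset hs
    rw [(hode s hs').2.2.1.deriv]
    exact (hode s hs').2.2.2.2.2
  have h0 : (0 : ℝ) ∈ Set.Icc 0 s₁ := ⟨le_rfl, hs₁.le⟩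
  have h1 : s₁ ∈ Set.Icc 0 s₁ := ⟨hs₁.le, le_rfl⟩
  have hx : AntitoneOn x (Set.Icc 0 s₁) := by
    refine antitoneOn_of_deriv_nonpos (convex_Icc _ _)
      (fun s hs => (hode s hs).1.continuousAt.continuousWithinAt)
      (fun s hs => (hode s (interior_subset hs)).1.differentiableAt.differentiableWithinAt)
      fun s hs => ?_
    have hs' := interior_subset hs
    rw [(hode s hs').1.deriv]
    refine div_nonpos_of_nonpos_of_nonneg ?_ (Real.sqrt_nonneg _)
    have l := hθmono.monotoneOn h0 hs' hs'.1
    have u := hθmono.monotoneOn hs' h1 hs'.2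
    exact Real.cos_nonpos_of_pi_div_two_le_of_le (by linarith) (by linarith)
  have hx4 (s) (hs : s ∈ Set.Icc 0 s₁) : 0 < 4 + κ * x s ^ 2 := by
    obtain ⟨-, -, -, hxs, hxb, -⟩ := hode s hs
    rcases hκ.eq_or_lt with rfl | hκ'
    · simp
    · have hk : 0 < Real.sqrt (-κ) := Real.sqrt_pos.2 (by linarith)
      have h2 := hxb hκ'
      rw [lt_div_iff₀ hk] at h2
      have h3 : (x s * Real.sqrt (-κ)) ^ 2 < 2 ^ 2 := by gcongr
      rw [mul_pow, Real.sq_sqrt (by linarith)] at h3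
      linarith
  have hsurj : ∀ y ∈ Set.Icc (θ 0) (θ s₁), ∃ s ∈ Set.Icc 0 s₁, θ s = y :=
    fun y hy => intermediate_value_Icc hs₁.le hθcont hy
  choose! ψ hψ hθψ using hsurj
  have hψc : ContinuousOn ψ (Set.Icc (θ 0) (θ s₁)) :=
    isCompact_Icc.continuousOn_of_rightInvOn hθcont hθmono.injOn hψ hθψ
  have hψd (y) (hy : y ∈ Set.Ioo (θ 0) (θ s₁)) : HasDerivAt ψ
      ((1 / ((4 + κ * x (ψ y) ^ 2) * Real.sqrt (1 + τ ^ 2 * x (ψ y) ^ 2))) *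
        (8 * h (Real.cos (θ (ψ y)) / Real.sqrt (1 + τ ^ 2 * x (ψ y) ^ 2))
          - ((4 - κ * x (ψ y) ^ 2) / x (ψ y)) * Real.sin (θ (ψ y))))⁻¹ y := by
    have hI := Icc_mem_nhds hy.1 hy.2
    have ho := hode _ (hψ y (Set.Ioo_subset_Icc_self hy))
    exact ho.2.2.1.of_local_left_inverse (hψc.continuousAt hI) ho.2.2.2.2.2.ne'
      (Filter.eventually_of_mem hI hθψ)
  have hzc : ContinuousOn (fun y => z (ψ y)) (Set.Icc (θ 0) (θ s₁)) :=
    ContinuousOn.comp (t := Set.Icc 0 s₁)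
      (fun s hs => (hode s hs).2.1.continuousAt.continuousWithinAt) hψc hψ
  have hG : StrictMonoOn (fun t => z (ψ (Real.pi + t)) - z (ψ (Real.pi - t)))
      (Set.Icc 0 (Real.pi / 2)) := by
    refine strictMonoOn_of_deriv_pos (convex_Icc _ _) (ContinuousOn.sub ?_ ?_) fun t ht => ?_
    · refine hzc.comp (f := fun t => Real.pi + t) (by fun_prop) fun t ht => ?_
      constructor <;> linarith [ht.1, ht.2]
    · refine hzc.comp (f := fun t => Real.pi - t) (by fun_prop) fun t ht => ?_
      constructor <;> linarith [ht.1, ht.2]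
    · rw [interior_Icc] at ht
      have hb : Real.pi + t ∈ Set.Ioo (θ 0) (θ s₁) := by
        constructor <;> linarith [ht.1, ht.2]
      have ha : Real.pi - t ∈ Set.Ioo (θ 0) (θ s₁) := by
        constructor <;> linarith [ht.1, ht.2]
      have hbI := Set.Ioo_subset_Icc_self hb
      have haI := Set.Ioo_subset_Icc_self ha
      have hob := hode _ (hψ _ hbI)
      have hoa := hode _ (hψ _ haI)
      have hdb := (hob.2.1.comp _ (hψd _ hb)).comp t ((hasDerivAt_id t).const_add Real.pi)
      have hda := (hoa.2.1.comp _ (hψd _ ha)).comp t ((hasDerivAt_id t).const_sub Real.pi)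
      have hd := hdb.sub hda
      have hle : ψ (Real.pi - t) ≤ ψ (Real.pi + t) := by
        rw [← hθmono.le_iff_le (hψ _ haI) (hψ _ hbI), hθψ _ haI, hθψ _ hbI]
        linarith [ht.1]
      have hYX := hx (hψ _ haI) (hψ _ hbI) hle
      have hXpos := hoa.2.2.2.2.2
      have sa : Real.sin (Real.pi - t) = Real.sin t := Real.sin_pi_sub t
      have ca : Real.cos (Real.pi - t) = -Real.cos t := Real.cos_pi_sub t
      have sb : Real.sin (Real.pi + t) = -Real.sin t := by rw [add_comm, Real.sin_add_pi]
      have cb : Real.cos (Real.pi + t) = -Real.cos t := by rw [add_comm, Real.cos_add_pi]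
      rw [hθψ _ haI, sa, ca] at hXpos
      rw [hθψ _ haI, hθψ _ hbI, sa, ca, sb, cb, mul_one, mul_neg_one, sub_neg_eq_add] at hd
      refine (nodoid_slope_add_pos hκ (Real.sin_pos_of_pos_of_lt_pi ht.1 (by linarith [ht.2]))
        ?_ (neg_le_neg (Real.cos_le_one t)) hob.2.2.2.1 hYX (hx4 _ (hψ _ haI))
        (hx4 _ (hψ _ hbI)) hmono hXpos).trans_eq hd.deriv.symm
      exact neg_nonpos.2 (Real.cos_nonneg_of_neg_pi_div_two_le_of_le (by linarith [ht.1]) ht.2.le)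
  have hlt := hG (Set.left_mem_Icc.2 (by positivity)) (Set.right_mem_Icc.2 (by positivity))
    (by positivity : (0 : ℝ) < Real.pi / 2)
  have hψ1 : ψ (Real.pi + Real.pi / 2) = s₁ := by
    have e : Real.pi + Real.pi / 2 = θ s₁ := by linarith
    have hm : θ s₁ ∈ Set.Icc (θ 0) (θ s₁) := ⟨by linarith, le_rfl⟩
    rw [e]
    exact hθmono.injOn (hψ _ hm) h1 (hθψ _ hm)
  have hψ0 : ψ (Real.pi - Real.pi / 2) = 0 := by
    have e : Real.pi - Real.pi / 2 = θ 0 := by linarith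
    have hm : θ 0 ∈ Set.Icc (θ 0) (θ s₁) := ⟨le_rfl, by linarith⟩
    rw [e]
    exact hθmono.injOn (hψ _ hm) h0 (hθψ _ hm)
  simp only [add_zero, sub_zero, sub_self, hψ1, hψ0] at hlt
  linarith
end
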